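/- arXiv:1506.08742 — 2 statements merged into one kernel-verified Lean document; each statement's English description precedes it below -/
import Mathlib

section
/- Let T : [−1,1] → ℝ be continuously differentiable. Then for every integer s ≥ 0 the series ∑_{r=s}^{∞} ⟨J_{r,1/2}, T⟩_{1/2} converges, and its sum equals ⟨J_{s,−1/2}, T⟩_{−1/2}. -/
open MeasureTheory Real

/-- Chebyshev polynomials of the second (`α = 1/2`) and third (`α = -1/2`) kind. -/
noncomputable def chebJ (α : ℝ) : ℕ → ℝ → ℝ
  | 0, _ => 1
  | 1, x => if α = 1 / 2 then 2 * x else 2 * x - 1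
  | n + 2, x => 2 * x * chebJ α (n + 1) x - chebJ α n x

/-- The normalized inner product `⟨f,g⟩_α`. -/
noncomputable def innerJ (α : ℝ) (f g : ℝ → ℝ) : ℝ :=
  (2 : ℝ) ^ (α + 1 / 2) / Real.pi *
    ∫ x in (-1 : ℝ)..1, f x * g x * (1 - x) ^ α * (1 + x) ^ ((1 : ℝ) / 2)

open Filter Topology intervalIntegral Set

/-- The cosine coefficients of a continuous function on `[0, π]` are square summable. -/
theorem summable_sq_integral_cos_mul {f : ℝ → ℝ} (hf : ContinuousOn f (Icc 0 π)) :
    Summable fun n : ℕ => (∫ θ in (0 : ℝ)..π, cos (n * θ) * f θ) ^ 2 := by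
  have hpi := Real.pi_pos
  have h2pi : (0 : ℝ) < 2 * π := by positivity
  set g : ℝ → ℂ := (Ioc 0 π).indicator fun θ => (f θ : ℂ) with hg
  have hmem : MemLp g 2 (volume.restrict (Ioc 0 (2 * π))) := by
    refine MemLp.restrict _ ?_
    rw [hg, memLp_indicator_iff_restrict measurableSet_Ioc]
    have hc : ContinuousOn (fun θ => (f θ : ℂ)) (Icc 0 π) :=
      Complex.continuous_ofReal.comp_continuousOn hf
    obtain ⟨C, hC⟩ := isCompact_Icc.exists_bound_of_continuousOn hc
    exact MemLp.of_bound ((hc.mono Ioc_subset_Icc_self).aestronglyMeasurable measurableSet_Ioc) C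
      (ae_restrict_of_forall_mem measurableSet_Ioc fun x hx => hC x (Ioc_subset_Icc_self hx))
  have hsum := (hasSum_sq_fourierCoeffOn h2pi hmem).summable.comp_injective Nat.cast_injective
  refine Summable.of_nonneg_of_le (fun _ => sq_nonneg _) (fun n => ?_) (hsum.mul_left ((2 * π) ^ 2))
  have hcoeff : ((2 * π : ℝ) : ℂ) * fourierCoeffOn h2pi g n =
      ∫ θ in (0 : ℝ)..π, Complex.exp (-(n * θ : ℝ) * Complex.I) * (f θ : ℂ) := by
    rw [fourierCoeffOn_eq_integral, integral_of_le h2pi.le, integral_of_le hpi.le, hg]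
    have : ∀ θ : ℝ, fourier (-(n : ℤ)) (θ : AddCircle (2 * π - 0)) •
        (Ioc 0 π).indicator (fun θ => (f θ : ℂ)) θ = (Ioc 0 π).indicator
          (fun θ => Complex.exp (-(n * θ : ℝ) * Complex.I) * (f θ : ℂ)) θ := by
      intro θ
      by_cases hθ : θ ∈ Ioc 0 π
      · simp only [hθ, indicator_of_mem, smul_eq_mul, fourier_coe_apply]
        congr 2
        have : (π : ℂ) ≠ 0 := by exact_mod_cast hpi.ne'
        push_cast
        field_simp
        ring
      · simp [hθ]
    simp_rw [this]
    rw [setIntegral_indicator measurableSet_Ioc, inter_eq_right.2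
      (Ioc_subset_Ioc_right (by linarith)), Complex.real_smul]
    have : (π : ℂ) ≠ 0 := by exact_mod_cast hpi.ne'
    rw [← mul_assoc, sub_zero]
    push_cast
    rw [mul_one_div_cancel (by simp), one_mul]
  have hre : (∫ θ in (0 : ℝ)..π, cos (n * θ) * f θ) =
      (∫ θ in (0 : ℝ)..π, Complex.exp (-(n * θ : ℝ) * Complex.I) * (f θ : ℂ)).re := by
    rw [← Complex.reCLM_apply, ← ContinuousLinearMap.intervalIntegral_comp_comm]
    · refine integral_congr fun θ _ => ?_
      simp only [Complex.reCLM_apply, Complex.re_mul_ofReal]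
      rw [← Complex.ofReal_neg, Complex.exp_ofReal_mul_I_re, cos_neg]
    · refine ContinuousOn.intervalIntegrable ?_
      rw [uIcc_of_le hpi.le]
      exact (by fun_prop : Continuous fun θ : ℝ =>
        Complex.exp (-(n * θ : ℝ) * Complex.I)).continuousOn.mul
          (Complex.continuous_ofReal.comp_continuousOn hf)
  rw [hre, ← hcoeff, ← sq_abs, Function.comp_apply, ← mul_pow]
  gcongr
  refine (Complex.abs_re_le_norm _).trans ?_
  rw [norm_mul, Complex.norm_real, norm_of_nonneg h2pi.le]

theorem chebJ_half_cos_mul_sin (n : ℕ) (θ : ℝ) :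
    chebJ (1 / 2) n (cos θ) * sin θ = sin ((n + 1) * θ) := by
  induction n using Nat.twoStepInduction with
  | zero => simp [chebJ]
  | one =>
    simp only [chebJ, if_true, Nat.cast_one]
    rw [one_add_one_eq_two, sin_two_mul]
    ring
  | more n h0 h1 =>
    have h : chebJ (1 / 2) (n + 2) (cos θ) * sin θ = 2 * cos θ *
        (chebJ (1 / 2) (n + 1) (cos θ) * sin θ) - chebJ (1 / 2) n (cos θ) * sin θ := by
      simp only [chebJ]; ring
    rw [h, h0, h1]
    push_cast
    have e1 : ((n : ℝ) + 2 + 1) * θ = (n + 1 + 1) * θ + θ := by ring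
    have e2 : ((n : ℝ) + 1) * θ = (n + 1 + 1) * θ - θ := by ring
    rw [e1, e2, sin_add, sin_sub]
    ring

theorem chebJ_neg_half_cos_mul_one_add_cos (n : ℕ) (θ : ℝ) :
    chebJ (-(1 / 2)) n (cos θ) * (1 + cos θ) = cos ((n + 1 : ℕ) * θ) + cos (n * θ) := by
  induction n using Nat.twoStepInduction with
  | zero => simp [chebJ, add_comm]
  | one =>
    have : ¬ (-(1 / 2) : ℝ) = 1 / 2 := by norm_num
    simp only [chebJ, this, if_false]
    push_cast
    rw [cos_two_mul]
    ring_nf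
  | more n h0 h1 =>
    have h : chebJ (-(1 / 2)) (n + 2) (cos θ) * (1 + cos θ) = 2 * cos θ *
        (chebJ (-(1 / 2)) (n + 1) (cos θ) * (1 + cos θ)) -
          chebJ (-(1 / 2)) n (cos θ) * (1 + cos θ) := by
      simp only [chebJ]; ring
    rw [h, h0, h1]
    push_cast
    have e1 : ((n : ℝ) + 2 + 1) * θ = (n + 1 + 1) * θ + θ := by ring
    have e2 : ((n : ℝ) + 2) * θ = (n + 1) * θ + θ := by ring
    have e3 : ((n : ℝ) + 1) * θ = (n + 1 + 1) * θ - θ := by ring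
    have e4 : (n : ℝ) * θ = (n + 1) * θ - θ := by ring
    have e5 : cos (n * θ) = cos ((n + 1) * θ - θ) := by rw [← e4]
    have e6 : cos ((n + 1 + 1) * θ - θ) = cos ((n + 1) * θ) := by rw [← e3]
    rw [e1, e2, e5, cos_add, cos_add ((n + 1) * θ), cos_sub]
    rw [cos_sub] at e6
    linear_combination e6

theorem chebJ_neg_half_sub_succ (n : ℕ) (x : ℝ) :
    chebJ (-(1 / 2)) n x - chebJ (-(1 / 2)) (n + 1) x = 2 * (1 - x) * chebJ (1 / 2) n x := by
  have : ¬ (-(1 / 2) : ℝ) = 1 / 2 := by norm_num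
  induction n using Nat.twoStepInduction with
  | zero => simp only [chebJ, this, if_false]; ring
  | one => simp only [chebJ, this, if_false, if_true]; ring
  | more n h0 h1 =>
    have e1 : chebJ (-(1 / 2)) (n + 2 + 1) x = 2 * x * chebJ (-(1 / 2)) (n + 2) x -
      chebJ (-(1 / 2)) (n + 1) x := rfl
    have e2 : chebJ (-(1 / 2)) (n + 2) x = 2 * x * chebJ (-(1 / 2)) (n + 1) x -
      chebJ (-(1 / 2)) n x := rfl
    have e3 : chebJ (1 / 2) (n + 2) x = 2 * x * chebJ (1 / 2) (n + 1) x -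
      chebJ (1 / 2) n x := rfl
    rw [e1, e3]
    linear_combination (2 * x) * h1 - h0 + e2

theorem innerJ_half_eq_integral_cos (f g : ℝ → ℝ) :
    innerJ (1 / 2) f g = 2 / π * ∫ θ in (0 : ℝ)..π, f (cos θ) * g (cos θ) * sin θ ^ 2 := by
  have h : ∫ x in (-1 : ℝ)..1, f x * g x * (1 - x) ^ (1 / 2 : ℝ) * (1 + x) ^ (1 / 2 : ℝ) =
      ∫ x in (-1 : ℝ)..1, f x * g x * (1 - x ^ 2) * √(1 - x ^ 2)⁻¹ := by
    refine integral_congr_Ioo_of_le (by norm_num) fun x hx => ?_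
    have h1 : 0 < 1 - x := by linarith [hx.2]
    have h2 : 0 < 1 + x := by linarith [hx.1]
    have h3 : 0 < 1 - x ^ 2 := by nlinarith
    have h4 : √(1 - x ^ 2) = √(1 - x) * √(1 + x) := by
      rw [← sqrt_mul h1.le]; ring_nf
    simp only [← sqrt_eq_rpow]
    rw [sqrt_inv, mul_assoc, ← h4, mul_assoc _ (1 - x ^ 2), ← div_eq_mul_inv, div_sqrt]
  rw [innerJ, h, ← Polynomial.Chebyshev.integral_measureT
    (fun x => f x * g x * (1 - x ^ 2)), Polynomial.Chebyshev.integral_measureT_eq_integral_cos]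
  simp_rw [← sin_sq]
  norm_num

theorem innerJ_neg_half_eq_integral_cos (f g : ℝ → ℝ) :
    innerJ (-(1 / 2)) f g =
      1 / π * ∫ θ in (0 : ℝ)..π, f (cos θ) * g (cos θ) * (1 + cos θ) := by
  have h : ∫ x in (-1 : ℝ)..1, f x * g x * (1 - x) ^ (-(1 / 2) : ℝ) * (1 + x) ^ (1 / 2 : ℝ) =
      ∫ x in (-1 : ℝ)..1, f x * g x * (1 + x) * √(1 - x ^ 2)⁻¹ := by
    refine integral_congr_Ioo_of_le (by norm_num) fun x hx => ?_
    have h1 : 0 < 1 - x := by linarith [hx.2]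
    have h2 : 0 < 1 + x := by linarith [hx.1]
    have h4 : √(1 - x ^ 2) = √(1 - x) * √(1 + x) := by
      rw [← sqrt_mul h1.le]; ring_nf
    have h5 : √(1 - x) ≠ 0 := (sqrt_pos.2 h1).ne'
    have h6 : √(1 + x) ≠ 0 := (sqrt_pos.2 h2).ne'
    simp only [rpow_neg h1.le, ← sqrt_eq_rpow]
    rw [sqrt_inv, h4]
    field_simp
    rw [sq_sqrt h2.le]
  rw [innerJ, h, ← Polynomial.Chebyshev.integral_measureT
    (fun x => f x * g x * (1 + x)), Polynomial.Chebyshev.integral_measureT_eq_integral_cos]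
  norm_num

theorem continuousOn_comp_cos {T : ℝ → ℝ} (hT : ContinuousOn T (Icc (-1) 1)) :
    ContinuousOn (fun θ => T (cos θ)) (Icc 0 π) :=
  hT.comp continuous_cos.continuousOn fun θ _ => cos_mem_Icc θ

theorem innerJ_neg_half_chebJ {T : ℝ → ℝ} (hT : ContinuousOn T (Icc (-1) 1)) (n : ℕ) :
    innerJ (-(1 / 2)) (chebJ (-(1 / 2)) n) T =
      1 / π * ((∫ θ in (0 : ℝ)..π, cos ((n + 1 : ℕ) * θ) * T (cos θ)) +
        ∫ θ in (0 : ℝ)..π, cos (n * θ) * T (cos θ)) := by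
  have hint (m : ℕ) : IntervalIntegrable (fun θ => cos (m * θ) * T (cos θ)) volume 0 π := by
    refine ContinuousOn.intervalIntegrable ?_
    rw [uIcc_of_le pi_pos.le]
    exact (by fun_prop : Continuous fun θ : ℝ => cos (m * θ)).continuousOn.mul
      (continuousOn_comp_cos hT)
  rw [innerJ_neg_half_eq_integral_cos, ← integral_add (hint _) (hint _)]
  congr 2 with θ
  linear_combination T (cos θ) * chebJ_neg_half_cos_mul_one_add_cos n θ

theorem continuous_chebJ (α : ℝ) (n : ℕ) : Continuous (chebJ α n) := by
  induction n using Nat.twoStepInduction with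
  | zero => exact continuous_const
  | one =>
    by_cases h : α = 1 / 2
    · simp only [chebJ, if_pos h]; fun_prop
    · simp only [chebJ, if_neg h]; fun_prop
  | more n h0 h1 => simp only [chebJ]; fun_prop

theorem innerJ_half_chebJ_eq_sub {T : ℝ → ℝ} (hT : ContinuousOn T (Icc (-1) 1)) (n : ℕ) :
    innerJ (1 / 2) (chebJ (1 / 2) n) T = innerJ (-(1 / 2)) (chebJ (-(1 / 2)) n) T -
      innerJ (-(1 / 2)) (chebJ (-(1 / 2)) (n + 1)) T := by
  have hint (m : ℕ) : IntervalIntegrable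
      (fun θ => chebJ (-(1 / 2)) m (cos θ) * T (cos θ) * (1 + cos θ)) volume 0 π := by
    refine ContinuousOn.intervalIntegrable ?_
    rw [uIcc_of_le pi_pos.le]
    exact (((continuous_chebJ _ m).comp continuous_cos).continuousOn.mul
      (continuousOn_comp_cos hT)).mul (by fun_prop)
  rw [innerJ_half_eq_integral_cos, innerJ_neg_half_eq_integral_cos,
    innerJ_neg_half_eq_integral_cos, ← mul_sub, ← integral_sub (hint _) (hint _),
    show 2 / π = 1 / π * 2 by ring, mul_assoc, ← intervalIntegral.integral_const_mul]
  congr 2 with θ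
  linear_combination (-T (cos θ) * (1 + cos θ)) * chebJ_neg_half_sub_succ n (cos θ) +
    2 * chebJ (1 / 2) n (cos θ) * T (cos θ) * sin_sq_add_cos_sq θ

theorem tendsto_innerJ_neg_half_chebJ {T : ℝ → ℝ} (hT : ContinuousOn T (Icc (-1) 1)) :
    Tendsto (fun n => innerJ (-(1 / 2)) (chebJ (-(1 / 2)) n) T) atTop (𝓝 0) := by
  have h : Tendsto (fun n : ℕ => ∫ θ in (0 : ℝ)..π, cos (n * θ) * T (cos θ)) atTop (𝓝 0) := by
    have := (summable_sq_integral_cos_mul (continuousOn_comp_cos hT)).tendsto_atTop_zero.sqrt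
    simp only [sqrt_sq_eq_abs, sqrt_zero] at this
    exact (tendsto_zero_iff_abs_tendsto_zero _).2 this
  simp_rw [innerJ_neg_half_chebJ hT]
  simpa using (((tendsto_add_atTop_iff_nat 1).2 h).add h).const_mul (1 / π)

theorem summable_innerJ_half_chebJ {T : ℝ → ℝ} (hT : ContDiffOn ℝ 1 T (Icc (-1) 1)) :
    Summable fun n => innerJ (1 / 2) (chebJ (1 / 2) n) T := by
  have hU : UniqueDiffOn ℝ (Icc (-1 : ℝ) 1) := uniqueDiffOn_Icc (by norm_num)
  set T' := derivWithin T (Icc (-1) 1)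
  have hTc := continuousOn_comp_cos hT.continuousOn
  have hT'c := continuousOn_comp_cos (hT.continuousOn_derivWithin hU le_rfl)
  let h' : ℝ → ℝ := fun θ => T' (cos θ) * -sin θ * sin θ + T (cos θ) * cos θ
  have hh'c : ContinuousOn h' (Icc 0 π) :=
    ((hT'c.mul (by fun_prop)).mul (by fun_prop)).add (hTc.mul (by fun_prop))
  have hderiv : ∀ θ ∈ Ioo 0 π, HasDerivAt (fun θ => T (cos θ) * sin θ) (h' θ) θ := by
    intro θ hθ
    have hs := sin_pos_of_mem_Ioo hθ
    have hnhds : Icc (-1 : ℝ) 1 ∈ 𝓝 (cos θ) := by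
      refine Icc_mem_nhds ?_ ?_ <;> nlinarith [sin_sq_add_cos_sq θ]
    have hd := ((hT.differentiableOn one_ne_zero _ (cos_mem_Icc θ)).hasDerivWithinAt).hasDerivAt
      hnhds
    exact (hd.comp θ (hasDerivAt_cos θ)).mul (hasDerivAt_sin θ)
  have hparts (n : ℕ) : innerJ (1 / 2) (chebJ (1 / 2) n) T =
      2 / π * (1 / ((n + 1 : ℕ) : ℝ) *
        ∫ θ in (0 : ℝ)..π, cos ((n + 1 : ℕ) * θ) * h' θ) := by
    have hn : ((n + 1 : ℕ) : ℝ) ≠ 0 := by positivity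
    have key := integral_mul_deriv_eq_deriv_mul_of_hasDerivAt (a := 0) (b := π)
      (u := fun θ => T (cos θ) * sin θ) (u' := h')
      (v := fun θ => -cos ((n + 1 : ℕ) * θ) / ((n + 1 : ℕ) : ℝ))
      (v' := fun θ => sin ((n + 1 : ℕ) * θ))
      (by rw [uIcc_of_le pi_pos.le]; exact hTc.mul (by fun_prop)) (by fun_prop)
      (by simpa [pi_pos.le] using hderiv)
      (fun θ _ => by
        have := ((hasDerivAt_id θ).const_mul ((n + 1 : ℕ) : ℝ)).cos.neg.div_const
          ((n + 1 : ℕ) : ℝ)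
        convert! this using 1
        simp only [id]
        field_simp)
      (by
        refine ContinuousOn.intervalIntegrable ?_
        rwa [uIcc_of_le pi_pos.le])
      (Continuous.intervalIntegrable (by fun_prop) _ _)
    simp only [sin_pi, sin_zero, mul_zero, zero_mul, sub_self, zero_sub] at key
    rw [innerJ_half_eq_integral_cos,
      ← intervalIntegral.integral_const_mul (1 / ((n + 1 : ℕ) : ℝ))]
    congr 1
    trans ∫ θ in (0 : ℝ)..π, T (cos θ) * sin θ * sin ((n + 1 : ℕ) * θ)
    · congr 1 with θ
      have := chebJ_half_cos_mul_sin n θ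
      push_cast
      linear_combination T (cos θ) * sin θ * this
    · rw [key, ← intervalIntegral.integral_neg]
      congr 1 with θ
      ring
  simp_rw [hparts]
  refine Summable.mul_left _ ?_
  have h1 := (summable_nat_add_iff 1).2 (summable_sq_integral_cos_mul hh'c)
  have h2 := (summable_nat_add_iff 1).2 (summable_one_div_nat_pow.2 one_lt_two)
  refine Summable.of_norm_bounded (h2.add h1) fun n => ?_
  rw [norm_mul, norm_eq_abs, norm_eq_abs, ← one_div_pow, ← sq_abs (1 / _),
    ← sq_abs (intervalIntegral _ _ _ _)]
  nlinarith [sq_nonneg (|1 / ((n + 1 : ℕ) : ℝ)| -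
    |∫ θ in (0 : ℝ)..π, cos ((n + 1 : ℕ) * θ) * h' θ|),
    sq_nonneg (|1 / ((n + 1 : ℕ) : ℝ)|),
    sq_nonneg (|∫ θ in (0 : ℝ)..π, cos ((n + 1 : ℕ) * θ) * h' θ|)]

/-- For `T` continuously differentiable on `[-1,1]`, the series
`∑_{r=s}^∞ ⟨J_{r,1/2}, T⟩_{1/2}` converges to `⟨J_{s,−1/2}, T⟩_{−1/2}`. -/
theorem tail_sum_second_kind (T : ℝ → ℝ)
    (hT : ContDiffOn ℝ 1 T (Set.Icc (-1 : ℝ) 1)) (s : ℕ) :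
    HasSum (fun r : ℕ => innerJ (1 / 2) (chebJ (1 / 2) (s + r)) T)
      (innerJ (-(1 / 2)) (chebJ (-(1 / 2)) s) T) := by
  have hsum : Summable fun r : ℕ => innerJ (1 / 2) (chebJ (1 / 2) (s + r)) T :=
    (summable_innerJ_half_chebJ hT).comp_injective (add_right_injective s)
  rw [hsum.hasSum_iff_tendsto_nat]
  have hpartial (N : ℕ) : ∑ r ∈ Finset.range N, innerJ (1 / 2) (chebJ (1 / 2) (s + r)) T =
      innerJ (-(1 / 2)) (chebJ (-(1 / 2)) s) T -
        innerJ (-(1 / 2)) (chebJ (-(1 / 2)) (s + N)) T := by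
    simp_rw [innerJ_half_chebJ_eq_sub hT.continuousOn]
    exact Finset.sum_range_sub' (fun r => innerJ (-(1 / 2)) (chebJ (-(1 / 2)) (s + r)) T) N
  simp_rw [hpartial, add_comm s]
  simpa using ((tendsto_add_atTop_iff_nat s).2
    (tendsto_innerJ_neg_half_chebJ hT.continuousOn)).const_sub
      (innerJ (-(1 / 2)) (chebJ (-(1 / 2)) s) T)
end

section
/- Character expansion of a product: let E be infinitely differentiable on a neighborhood of [−1,1], let r ≥ 1, let α ∈ {1/2, −1/2}, and let x_1, …, x_r ∈ [−1,1]. Then, with μ̃_j := μ_j + r − j, the sum over all partitions μ = (μ_1 ≥ … ≥ μ_r ≥ 0) of length at most r of det[⟨J_{μ̃_j,α}, (x−1)^{r−i}·E⟩_α]_{i,j=1}^{r} · det[J_{μ̃_i,α}(x_j)]_{i,j=1}^{r} converges absolutely and equals (∏_{k=1}^{r} E(x_k)) · det[(x_j − 1)^{r−i}]_{i,j=1}^{r}. -/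
open MeasureTheory Real

theorem HasSum.mul_real {ι κ : Type*} {f : ι → ℝ} {g : κ → ℝ} {s t : ℝ}
    (hf : HasSum f s) (hg : HasSum g t) :
    HasSum (fun p : ι × κ => f p.1 * g p.2) (s * t) := by
  have := summable_mul_of_summable_norm (f := f) (g := g) hf.summable.norm hg.summable.norm
  exact hf.mul hg this

theorem hasSum_prod_apply {ι : Type*} {r : ℕ} {f : Fin r → ι → ℝ} {s : Fin r → ℝ}
    (h : ∀ j, HasSum (f j) (s j)) :
    HasSum (fun n : Fin r → ι => ∏ j, f j (n j)) (∏ j, s j) := by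
  induction r with
  | zero => simp
  | succ r ih =>
    have hs := ih (f := fun j => f j.succ) (s := fun j => s j.succ) fun j => h j.succ
    rw [Fin.prod_univ_succ, ← (Fin.consEquiv fun _ : Fin (r + 1) => ι).hasSum_iff]
    simpa [Function.comp_def, Fin.prod_univ_succ] using (h 0).mul_real hs

/-- The strictly decreasing tuple `m_j + (r - 1 - j)` attached to a partition `m`. -/
def addStaircase {r : ℕ} (m : Fin r → ℕ) (j : Fin r) : ℕ := m j + (r - 1 - (j : ℕ))

theorem addStaircase_strictAnti {r : ℕ} {m : Fin r → ℕ} (hm : Antitone m) :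
    StrictAnti (addStaircase m) := by
  intro i j hij
  have := hm hij.le
  have h2 : (i : ℕ) < j := hij
  have := j.isLt
  simp only [addStaircase]
  omega

theorem addStaircase_injective {r : ℕ} :
    Function.Injective (addStaircase : (Fin r → ℕ) → Fin r → ℕ) := fun m m' h => by
  ext j
  simpa [addStaircase] using congrFun h j

theorem exists_antitone_addStaircase_eq {r : ℕ} {ν : Fin r → ℕ} (hν : StrictAnti ν) :
    ∃ m, Antitone m ∧ addStaircase m = ν := by
  have key : ∀ i j : Fin r, i ≤ j → ν j + (j - i : ℕ) ≤ ν i := by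
    intro i j hij
    obtain ⟨d, hd⟩ := Nat.exists_eq_add_of_le (show (i : ℕ) ≤ j from hij)
    induction d generalizing j with
    | zero =>
      obtain rfl : i = j := Fin.ext (by omega)
      simp
    | succ d ih =>
      have hlt : (i : ℕ) + d < r := by omega
      have h1 := ih ⟨i + d, hlt⟩ (by simp [Fin.le_def]) rfl
      have h2 := hν (show (⟨i + d, hlt⟩ : Fin r) < j from Fin.lt_def.2 (by simp only; omega))
      simp only at h1
      omega
  have hlast : ∀ j : Fin r, r - 1 - (j : ℕ) ≤ ν j := fun j => by
    have hj := j.isLt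
    have hr : r - 1 < r := by omega
    have := key j ⟨r - 1, hr⟩ (show (j : ℕ) ≤ r - 1 by omega)
    simp only at this
    omega
  refine ⟨fun j => ν j - (r - 1 - j), fun i j hij => ?_, ?_⟩
  · have := key i j hij
    have := hlast j
    have h2 : (i : ℕ) ≤ j := hij
    simp only
    omega
  · ext j
    have := hlast j
    simp only [addStaircase]
    omega

theorem injective_addStaircase_comp_perm {r : ℕ} :
    Function.Injective fun p : { m : Fin r → ℕ // Antitone m } × Equiv.Perm (Fin r) =>
      addStaircase p.1.1 ∘ p.2 := by
  rintro ⟨m, σ⟩ ⟨m', τ⟩ h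
  simp only at h
  have hm := addStaircase_strictAnti m.2
  have hm' : StrictAnti (addStaircase m'.1) := addStaircase_strictAnti m'.2
  have e : addStaircase m.1 = addStaircase m'.1 := by
    have h1 : addStaircase m.1 ∘ (σ * τ⁻¹ : Equiv.Perm (Fin r)) = addStaircase m'.1 := by
      ext j
      simpa using congrFun h (τ⁻¹ j)
    have := Tuple.unique_antitone (f := addStaircase m.1) (σ := 1) (τ := σ * τ⁻¹)
      (by simpa using hm.antitone) (by rw [h1]; exact hm'.antitone)
    rw [← h1, ← this]
    rfl
  obtain rfl : m = m' := Subtype.ext (addStaircase_injective e)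
  exact Prod.ext rfl (Equiv.ext fun j => hm.injective (congrFun h j))

theorem mem_range_addStaircase_comp_perm {r : ℕ} {n : Fin r → ℕ} (hn : Function.Injective n) :
    n ∈ Set.range fun p : { m : Fin r → ℕ // Antitone m } × Equiv.Perm (Fin r) =>
      addStaircase p.1.1 ∘ p.2 := by
  have hanti : StrictAnti (n ∘ (Fin.revPerm.trans (Tuple.sort n))) :=
    ((Tuple.monotone_sort n).comp_antitone Fin.rev_anti).strictAnti_of_injective
      (hn.comp (Equiv.injective (Fin.revPerm.trans (Tuple.sort n))))
  obtain ⟨m, hm, e⟩ := exists_antitone_addStaircase_eq hanti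
  refine ⟨(⟨m, hm⟩, (Fin.revPerm.trans (Tuple.sort n))⁻¹), ?_⟩
  ext j
  simp [e]

/-- The Cauchy–Binet formula for infinite sums, indexed by partitions of length at most `r`. -/
theorem hasSum_det_mul_det {r : ℕ} {a b : Fin r → ℕ → ℝ} {s : Matrix (Fin r) (Fin r) ℝ}
    (h : ∀ i j, HasSum (fun n => a i n * b j n) (s i j)) :
    HasSum (fun m : { m : Fin r → ℕ // Antitone m } =>
      Matrix.det (Matrix.of fun i j => a i (addStaircase m.1 j)) *
        Matrix.det (Matrix.of fun i j => b j (addStaircase m.1 i))) s.det := by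
  set F : (Fin r → ℕ) → ℝ := fun n =>
    Matrix.det (Matrix.of fun i j => a i (n j)) * ∏ j, b j (n j) with hF
  have hsum : HasSum F s.det := by
    have hFσ : F = fun n => ∑ σ : Equiv.Perm (Fin r),
        ((Equiv.Perm.sign σ : ℤ) : ℝ) * ∏ j, a (σ j) (n j) * b j (n j) := by
      ext n
      simp only [hF]
      rw [Matrix.det_apply', Finset.sum_mul]
      simp only [Finset.prod_mul_distrib, Matrix.of_apply, mul_assoc]
    rw [Matrix.det_apply', hFσ]
    exact hasSum_sum (s := (Finset.univ : Finset (Equiv.Perm (Fin r)))) fun σ _ =>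
      (hasSum_prod_apply fun j => h (σ j) j).mul_left ((Equiv.Perm.sign σ : ℤ) : ℝ)
  have hsupp : ∀ n ∉ Set.range fun p : { m : Fin r → ℕ // Antitone m } × Equiv.Perm (Fin r) =>
      addStaircase p.1.1 ∘ p.2, F n = 0 := by
    intro n hn
    have hni : ¬ Function.Injective n := fun hi => hn (mem_range_addStaircase_comp_perm hi)
    simp only [Function.Injective, not_forall] at hni
    obtain ⟨i, j, hij, hne⟩ := hni
    simp only [hF]
    rw [Matrix.det_zero_of_column_eq hne (fun k => by simp [hij]), zero_mul]
  rw [← injective_addStaircase_comp_perm.hasSum_iff hsupp] at hsum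
  convert hsum.prod_fiberwise (fun m => hasSum_fintype _) using 2 with m
  have hcol : ∀ σ : Equiv.Perm (Fin r),
      Matrix.det (Matrix.of fun i j => a i (addStaircase m.1 (σ j))) =
        (Equiv.Perm.sign σ : ℤ) * Matrix.det (Matrix.of fun i j => a i (addStaircase m.1 j)) :=
    fun σ => Matrix.det_permute' σ (Matrix.of fun i j => a i (addStaircase m.1 j))
  rw [Matrix.det_apply' (Matrix.of fun i j => b j (addStaircase m.1 i)), Finset.mul_sum]
  refine Finset.sum_congr rfl fun σ _ => ?_
  simp only [hF, Function.comp_apply, hcol, Matrix.of_apply]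
  ring

theorem exists_pow_mul_norm_fourierCoeffOn_le {a b : ℝ} (hab : a < b) (k : ℕ) {h : ℝ → ℂ}
    (hc : ContDiff ℝ k h) (hper : Function.Periodic h (b - a)) :
    ∃ C, 0 ≤ C ∧ ∀ n : ℤ, |(n : ℝ)| ^ k * ‖fourierCoeffOn hab h n‖ ≤ C := by
  induction k generalizing h with
  | zero =>
    obtain ⟨C, hC⟩ := isCompact_Icc.exists_bound_of_continuousOn
      (hc.continuous.continuousOn (s := Set.Icc a b))
    have hC0 : 0 ≤ C := (norm_nonneg _).trans (hC a ⟨le_rfl, hab.le⟩)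
    refine ⟨C, hC0, fun n => ?_⟩
    have hpos : 0 < b - a := sub_pos.2 hab
    have := intervalIntegral.norm_integral_le_of_norm_le_const (a := a) (b := b) (C := C)
      (f := fun x : ℝ => fourier (-n) (x : AddCircle (b - a)) • h x) (fun x hx => by
        rw [Set.uIoc_of_le hab.le] at hx
        rw [norm_smul, fourier_apply, Circle.norm_coe, one_mul]
        exact hC x ⟨hx.1.le, hx.2⟩)
    rw [pow_zero, one_mul, fourierCoeffOn_eq_integral, norm_smul, norm_of_nonneg (by positivity),
      one_div, inv_mul_le_iff₀ hpos]
    rwa [abs_of_pos hpos, mul_comm] at this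
  | succ k ih =>
    have hc' : ContDiff ℝ k (deriv h) := by
      have := (contDiff_succ_iff_deriv (n := (k : WithTop ℕ∞))).1 (by exact_mod_cast hc)
      exact this.2.2
    have hd : Differentiable ℝ h := hc.differentiable (by simp)
    have hper' : Function.Periodic (deriv h) (b - a) := fun x => by
      rw [← deriv_comp_add_const]
      congr 1
      exact funext hper
    obtain ⟨C, hC0, hC⟩ := ih hc' hper'
    have hpos : 0 < b - a := sub_pos.2 hab
    refine ⟨(b - a) / (2 * π) * C, by positivity, fun n => ?_⟩
    rcases eq_or_ne n 0 with rfl | hn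
    · simp only [Int.cast_zero, abs_zero, zero_pow k.succ_ne_zero, zero_mul]
      positivity
    · have hn' : 0 < |(n : ℝ)| := by positivity
      have hends : h b = h a := by simpa using hper a
      rw [fourierCoeffOn_of_hasDerivAt hab hn (fun x _ => (hd x).hasDerivAt)
        (hc'.continuous.intervalIntegrable _ _), hends, sub_self, mul_zero, zero_sub]
      have e : ‖(b : ℂ) - a‖ = b - a := by
        rw [← Complex.ofReal_sub, Complex.norm_real, norm_of_nonneg hpos.le]
      simp only [norm_mul, norm_neg, norm_div, norm_one, Complex.norm_I, Complex.norm_real,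
        Complex.norm_ofNat, Complex.norm_intCast, e, norm_of_nonneg pi_pos.le, mul_one]
      calc _ = (b - a) / (2 * π) * (|(n : ℝ)| ^ k * ‖fourierCoeffOn hab (deriv h) n‖) := by
            field_simp
            ring
        _ ≤ _ := by gcongr; exact hC n

/-- The cosine coefficients, normalized so that a smooth even `2π`-periodic `h` satisfies
`h θ = c 0 + 2 ∑_{n ≥ 1} c n cos (n θ)`. -/
noncomputable def cosCoeff (h : ℝ → ℝ) (n : ℕ) : ℝ := 1 / π * ∫ θ in 0..π, h θ * cos (n * θ)

theorem fourierCoeffOn_eq_cosCoeff {h : ℝ → ℝ} (hc : Continuous h) (heven : ∀ θ, h (-θ) = h θ)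
    (hab : -π < -π + 2 * π) (n : ℤ) :
    fourierCoeffOn hab (fun θ => (h θ : ℂ)) n = cosCoeff h n.natAbs := by
  have hcos : ∀ θ : ℝ, cos ((n.natAbs : ℕ) * θ) = cos (n * θ) := fun θ => by
    rcases Int.natAbs_eq n with e | e
    · conv_rhs => rw [e]
      simp
    · conv_rhs => rw [e]
      simp
  have hexp : ∀ θ : ℝ, (fourier (-n) (θ : AddCircle (-π + 2 * π - -π)) : ℂ) =
      Complex.exp (-(n * θ * Complex.I)) := fun θ => by
    rw [fourier_coe_apply]
    congr 1
    push_cast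
    field_simp
    ring
  have hneg : ∫ θ in -π..0, Complex.exp (-(n * (θ : ℂ) * Complex.I)) * (h θ : ℂ) =
      ∫ θ in 0..π, Complex.exp (n * (θ : ℂ) * Complex.I) * (h θ : ℂ) := by
    have := intervalIntegral.integral_comp_neg (a := 0) (b := π)
      fun θ : ℝ => Complex.exp (-(n * (θ : ℂ) * Complex.I)) * (h θ : ℂ)
    rw [neg_zero] at this
    rw [← this]
    simp [heven]
  rw [fourierCoeffOn_eq_integral]
  simp only [hexp, smul_eq_mul]
  rw [show -π + 2 * π = π by ring, ← intervalIntegral.integral_add_adjacent_intervals (b := 0),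
    hneg, ← intervalIntegral.integral_add]
  · have : ∀ θ : ℝ, Complex.exp (n * (θ : ℂ) * Complex.I) * (h θ : ℂ) +
        Complex.exp (-(n * (θ : ℂ) * Complex.I)) * (h θ : ℂ) =
        ((2 * (h θ * cos (n * θ)) : ℝ) : ℂ) := fun θ => by
      rw [← add_mul]
      push_cast
      rw [Complex.cos, neg_mul]
      ring
    simp only [this]
    rw [intervalIntegral.integral_ofReal, intervalIntegral.integral_const_mul, cosCoeff]
    simp only [hcos]
    rw [Complex.real_smul]
    norm_cast
    field_simp
    ring
  all_goals
    apply Continuous.intervalIntegrable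
    fun_prop

theorem summable_mul_cosCoeff {h : ℝ → ℝ} (hc : ContDiff ℝ 3 h)
    (hper : Function.Periodic h (2 * π)) (heven : ∀ θ, h (-θ) = h θ) :
    Summable fun n : ℕ => (n + 1 : ℝ) * |cosCoeff h n| := by
  have hab : -π < -π + 2 * π := by linarith [pi_pos]
  obtain ⟨C, hC0, hC⟩ := exists_pow_mul_norm_fourierCoeffOn_le hab 3
    (h := fun θ => (h θ : ℂ)) (Complex.ofRealCLM.contDiff.comp hc) (fun θ => by
      have := hper θ
      simp only [add_sub_cancel_left]
      rw [this])
  rw [← summable_nat_add_iff 1]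
  refine Summable.of_nonneg_of_le (fun n => by positivity) (fun n => ?_)
    (((summable_nat_add_iff 1).2 (Real.summable_one_div_nat_pow.2 one_lt_two)).mul_left (2 * C))
  have := hC ((n + 1 : ℕ) : ℤ)
  rw [fourierCoeffOn_eq_cosCoeff hc.continuous heven, Complex.norm_real, Int.natAbs_natCast,
    norm_eq_abs, Int.cast_natCast, abs_of_nonneg (by positivity)] at this
  set A := |cosCoeff h (n + 1)|
  have hA : 0 ≤ A := abs_nonneg _
  push_cast at this ⊢
  rw [mul_one_div, le_div_iff₀ (by positivity)]
  have hn : (0 : ℝ) ≤ n := n.cast_nonneg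
  calc (n + 1 + 1 : ℝ) * A * (n + 1) ^ 2 ≤ (2 * (n + 1)) * A * (n + 1) ^ 2 := by
        gcongr; linarith
    _ = 2 * ((n + 1) ^ 3 * A) := by ring
    _ ≤ 2 * C := by gcongr

theorem hasSum_cosCoeff {h : ℝ → ℝ} (hc : ContDiff ℝ 3 h)
    (hper : Function.Periodic h (2 * π)) (heven : ∀ θ, h (-θ) = h θ) (θ : ℝ) :
    HasSum (fun n : ℕ => 2 * cosCoeff h n * cos (n * θ)) (h θ + cosCoeff h 0) := by
  have hab : -π < -π + 2 * π := by linarith [pi_pos]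
  have : Fact (0 < 2 * π) := ⟨by positivity⟩
  have hperC : Function.Periodic (fun θ => (h θ : ℂ)) (2 * π) := fun θ => by simp only [hper θ]
  let H : C(AddCircle (2 * π), ℂ) :=
    ⟨hperC.lift, continuous_coinduced_dom.2 (Complex.continuous_ofReal.comp hc.continuous)⟩
  have hcoe : ∀ n : ℤ, fourierCoeff H n = cosCoeff h n.natAbs := fun n => by
    rw [← fourierCoeffOn_eq_cosCoeff hc.continuous heven hab, fourierCoeffOn_eq_integral,
      fourierCoeff_eq_intervalIntegral _ _ (-π), add_sub_cancel_left]
    rfl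
  have hs : Summable fun n : ℕ => cosCoeff h n :=
    .of_norm_bounded (summable_mul_cosCoeff hc hper heven) fun n => by
      rw [norm_eq_abs]
      nlinarith [abs_nonneg (cosCoeff h n), n.cast_nonneg (α := ℝ)]
  have hsC : Summable (fourierCoeff H) := by
    have hsC' : Summable fun n : ℕ => (cosCoeff h n : ℂ) := Complex.summable_ofReal.2 hs
    apply Summable.of_nat_of_neg <;> simpa [hcoe] using hsC'
  have key := (has_pointwise_sum_fourier_series_of_summable hsC (θ : AddCircle (2 * π))).nat_add_neg
  have hH : H (θ : AddCircle (2 * π)) = h θ := rfl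
  rw [← Complex.hasSum_ofReal]
  convert key using 2 with n
  · simp only [hcoe, fourier_coe_apply]
    have e : ∀ m : ℂ, 2 * π * Complex.I * m * θ / ((2 * π : ℝ) : ℂ) = m * θ * Complex.I :=
      fun m => by
        push_cast
        field_simp
    simp only [e, Int.natAbs_neg, Int.natAbs_natCast, smul_eq_mul]
    push_cast
    rw [Complex.cos]
    ring_nf
  · simp [hcoe, hH]

theorem cos_add_two_mul (n : ℕ) (θ : ℝ) :
    cos ((n + 2 : ℕ) * θ) = 2 * cos θ * cos ((n + 1 : ℕ) * θ) - cos (n * θ) := by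
  have h1 : ((n + 2 : ℕ) : ℝ) * θ = (n + 1 : ℕ) * θ + θ := by push_cast; ring
  have h2 : (n : ℝ) * θ = (n + 1 : ℕ) * θ - θ := by push_cast; ring
  rw [h1, h2, cos_add, cos_sub]
  ring

theorem chebJ_half_mul_sin_sq (n : ℕ) (θ : ℝ) :
    2 * (chebJ (1 / 2) n (cos θ) * (1 - cos θ ^ 2)) = cos (n * θ) - cos ((n + 2 : ℕ) * θ) := by
  induction n using Nat.twoStepInduction with
  | zero => simp [chebJ, cos_two_mul]; ring
  | one =>
    simp only [chebJ, cos_add_two_mul 1, cos_add_two_mul 0]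
    simp
    ring
  | more n h0 h1 =>
    rw [chebJ, cos_add_two_mul (n + 2), cos_add_two_mul n]
    linear_combination 2 * cos θ * h1 - h0 + cos_add_two_mul n θ

theorem chebJ_neg_half_mul (n : ℕ) (θ : ℝ) :
    chebJ (-(1 / 2)) n (cos θ) * (1 + cos θ) = cos (n * θ) + cos ((n + 1 : ℕ) * θ) := by
  have hne : ¬(-(1 / 2) : ℝ) = 1 / 2 := by norm_num
  induction n using Nat.twoStepInduction with
  | zero => simp [chebJ]
  | one =>
    simp only [chebJ, if_neg hne, cos_add_two_mul 0]
    simp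
    ring
  | more n h0 h1 =>
    rw [chebJ, cos_add_two_mul (n + 1), cos_add_two_mul n]
    linear_combination 2 * cos θ * h1 - h0 + 2 * cos θ * cos_add_two_mul n θ

theorem chebJ_half_add_two_sub (n : ℕ) (θ : ℝ) :
    chebJ (1 / 2) (n + 2) (cos θ) - chebJ (1 / 2) n (cos θ) = 2 * cos ((n + 2 : ℕ) * θ) := by
  induction n using Nat.twoStepInduction with
  | zero => simp [chebJ, cos_two_mul]; ring
  | one =>
    simp only [chebJ, cos_add_two_mul 1, cos_add_two_mul 0]
    simp
    ring
  | more n h0 h1 =>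
    rw [chebJ, cos_add_two_mul (n + 2)]
    nth_rw 3 [chebJ]
    linear_combination 2 * cos θ * h1 - h0

theorem chebJ_neg_half_succ_add (n : ℕ) (θ : ℝ) :
    chebJ (-(1 / 2)) (n + 1) (cos θ) + chebJ (-(1 / 2)) n (cos θ) =
      2 * cos ((n + 1 : ℕ) * θ) := by
  have hne : ¬(-(1 / 2) : ℝ) = 1 / 2 := by norm_num
  induction n using Nat.twoStepInduction with
  | zero => simp only [chebJ, if_neg hne, zero_add]; simp
  | one =>
    simp only [chebJ, if_neg hne, cos_add_two_mul 0]
    simp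
    ring
  | more n h0 h1 =>
    have hrec : ∀ k, chebJ (-(1 / 2)) (k + 2) (cos θ) =
        2 * cos θ * chebJ (-(1 / 2)) (k + 1) (cos θ) - chebJ (-(1 / 2)) k (cos θ) := fun _ => rfl
    rw [cos_add_two_mul (n + 1)]
    linear_combination hrec (n + 1) + hrec n + 2 * cos θ * h1 - h0

theorem abs_chebJ_half_le (n : ℕ) (θ : ℝ) : |chebJ (1 / 2) n (cos θ)| ≤ 2 * (n + 1) := by
  induction n using Nat.twoStepInduction with
  | zero => simp [chebJ]
  | one =>
    have := abs_cos_le_one θ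
    simp only [chebJ, if_true, abs_mul, Nat.abs_ofNat]
    push_cast
    linarith
  | more n h0 _ =>
    have h := chebJ_half_add_two_sub n θ
    have := abs_le.1 (abs_cos_le_one ((n + 2 : ℕ) * θ))
    rw [abs_le] at h0 ⊢
    push_cast at *
    constructor <;> linarith

theorem abs_chebJ_neg_half_le (n : ℕ) (θ : ℝ) :
    |chebJ (-(1 / 2)) n (cos θ)| ≤ 2 * (n + 1) := by
  induction n with
  | zero => simp [chebJ]
  | succ n h0 =>
    have h := chebJ_neg_half_succ_add n θ
    have := abs_le.1 (abs_cos_le_one ((n + 1 : ℕ) * θ))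
    rw [abs_le] at h0 ⊢
    push_cast at *
    constructor <;> linarith

theorem integral_eq_integral_comp_cos {f g : ℝ → ℝ}
    (hfg : ∀ x ∈ Set.Ioo (-1 : ℝ) 1, f x = g x * √(1 - x ^ 2)⁻¹) :
    ∫ x in (-1 : ℝ)..1, f x = ∫ θ in 0..π, g (cos θ) := by
  rw [← Polynomial.Chebyshev.integral_measureT_eq_integral_cos,
    Polynomial.Chebyshev.integral_measureT]
  exact intervalIntegral.integral_congr_Ioo_of_le (by norm_num) hfg

theorem innerJ_half (f : ℝ → ℝ) (hf : Continuous fun θ => f (cos θ)) (n : ℕ) :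
    innerJ (1 / 2) (chebJ (1 / 2) n) f =
      cosCoeff (fun θ => f (cos θ)) n - cosCoeff (fun θ => f (cos θ)) (n + 2) := by
  rw [innerJ, integral_eq_integral_comp_cos (g := fun x => chebJ (1 / 2) n x * f x * (1 - x ^ 2))]
  · rw [cosCoeff, cosCoeff, ← mul_sub, ← intervalIntegral.integral_sub]
    · have : ∀ θ : ℝ, f (cos θ) * cos (n * θ) - f (cos θ) * cos ((n + 2 : ℕ) * θ) =
          2 * (chebJ (1 / 2) n (cos θ) * f (cos θ) * (1 - cos θ ^ 2)) := fun θ => by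
        linear_combination -f (cos θ) * chebJ_half_mul_sin_sq n θ
      simp only [this, intervalIntegral.integral_const_mul]
      norm_num
      ring
    all_goals
      exact (hf.mul (by fun_prop)).intervalIntegrable _ _
  · intro x hx
    have h1 : 0 < 1 - x := by linarith [hx.2]
    have h2 : 0 < 1 + x := by linarith [hx.1]
    have h3 : 0 < 1 - x ^ 2 := by nlinarith
    rw [← sqrt_eq_rpow, ← sqrt_eq_rpow, mul_assoc _ (√(1 - x)), ← sqrt_mul h1.le,
      show (1 - x) * (1 + x) = 1 - x ^ 2 by ring, sqrt_inv, mul_assoc _ (1 - x ^ 2)]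
    congr 1
    rw [← div_eq_mul_inv, div_sqrt]

theorem innerJ_neg_half (f : ℝ → ℝ) (hf : Continuous fun θ => f (cos θ)) (n : ℕ) :
    innerJ (-(1 / 2)) (chebJ (-(1 / 2)) n) f =
      cosCoeff (fun θ => f (cos θ)) n + cosCoeff (fun θ => f (cos θ)) (n + 1) := by
  rw [innerJ, integral_eq_integral_comp_cos (g := fun x => chebJ (-(1 / 2)) n x * f x * (1 + x))]
  · rw [cosCoeff, cosCoeff, ← mul_add, ← intervalIntegral.integral_add]
    · have : ∀ θ : ℝ, f (cos θ) * cos (n * θ) + f (cos θ) * cos ((n + 1 : ℕ) * θ) =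
          chebJ (-(1 / 2)) n (cos θ) * f (cos θ) * (1 + cos θ) := fun θ => by
        linear_combination -f (cos θ) * chebJ_neg_half_mul n θ
      simp only [this]
      norm_num
    all_goals
      exact (hf.mul (by fun_prop)).intervalIntegrable _ _
  · intro x hx
    have h1 : 0 < 1 - x := by linarith [hx.2]
    have h2 : 0 < 1 + x := by linarith [hx.1]
    rw [rpow_neg h1.le, ← sqrt_eq_rpow, ← sqrt_eq_rpow,
      show 1 - x ^ 2 = (1 - x) * (1 + x) by ring, sqrt_inv, sqrt_mul h1.le]
    have := sqrt_pos.2 h1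
    have := sqrt_pos.2 h2
    field_simp
    rw [sq_sqrt h2.le]

theorem hasSum_innerJ_mul_chebJ {α : ℝ} (hα : α = 1 / 2 ∨ α = -(1 / 2)) {f : ℝ → ℝ} {U : Set ℝ}
    (hsub : Set.Icc (-1 : ℝ) 1 ⊆ U) (hf : ContDiffOn ℝ 3 f U) {x : ℝ}
    (hx : x ∈ Set.Icc (-1 : ℝ) 1) :
    HasSum (fun n => innerJ α (chebJ α n) f * chebJ α n x) (f x) := by
  obtain ⟨θ, -, rfl⟩ := surjOn_cos hx
  set h : ℝ → ℝ := fun θ => f (cos θ) with h_def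
  have hc : ContDiff ℝ 3 h := hf.comp_contDiff contDiff_cos fun θ => hsub (cos_mem_Icc θ)
  have hper : Function.Periodic h (2 * π) := fun θ => by simp [h_def]
  have heven : ∀ θ, h (-θ) = h θ := fun θ => by simp [h_def]
  have hS := summable_mul_cosCoeff hc hper heven
  have hT := hasSum_cosCoeff hc hper heven θ
  have hbd : ∀ J : ℕ → ℝ, (∀ n, |J n| ≤ 2 * (n + 1)) →
      Summable fun n => cosCoeff h n * J n := fun J hJ =>
    .of_norm_bounded (hS.mul_left 2) fun n => by
      rw [norm_mul, norm_eq_abs, norm_eq_abs]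
      nlinarith [hJ n, abs_nonneg (cosCoeff h n)]
  rcases hα with rfl | rfl
  · have h0 := (hbd _ fun n => abs_chebJ_half_le n θ).hasSum
    set S := ∑' n, cosCoeff h n * chebJ (1 / 2) n (cos θ)
    have h2 := (hasSum_nat_add_iff' 2).2 h0
    have hT2 := (hasSum_nat_add_iff' 2).2 hT
    have hterm : (fun n => innerJ (1 / 2) (chebJ (1 / 2) n) f * chebJ (1 / 2) n (cos θ)) = fun n =>
        cosCoeff h n * chebJ (1 / 2) n (cos θ) -
          (cosCoeff h (n + 2) * chebJ (1 / 2) (n + 2) (cos θ) -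
            2 * cosCoeff h (n + 2) * cos ((n + 2 : ℕ) * θ)) := by
      ext n
      rw [innerJ_half f hc.continuous]
      linear_combination cosCoeff h (n + 2) * chebJ_half_add_two_sub n θ
    have hval : f (cos θ) = S -
        (S - ∑ i ∈ Finset.range 2, cosCoeff h i * chebJ (1 / 2) i (cos θ) -
          (h θ + cosCoeff h 0 - ∑ i ∈ Finset.range 2, 2 * cosCoeff h i * cos (i * θ))) := by
      simp [Finset.sum_range_succ, chebJ]
      ring
    rw [hterm, hval]
    exact h0.sub (h2.sub hT2)
  · have h0 := (hbd _ fun n => abs_chebJ_neg_half_le n θ).hasSum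
    set S := ∑' n, cosCoeff h n * chebJ (-(1 / 2)) n (cos θ)
    have h2 := (hasSum_nat_add_iff' 1).2 h0
    have hT2 := (hasSum_nat_add_iff' 1).2 hT
    have hterm : (fun n =>
        innerJ (-(1 / 2)) (chebJ (-(1 / 2)) n) f * chebJ (-(1 / 2)) n (cos θ)) = fun n =>
        cosCoeff h n * chebJ (-(1 / 2)) n (cos θ) -
          (cosCoeff h (n + 1) * chebJ (-(1 / 2)) (n + 1) (cos θ) -
            2 * cosCoeff h (n + 1) * cos ((n + 1 : ℕ) * θ)) := by
      ext n
      rw [innerJ_neg_half f hc.continuous]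
      linear_combination cosCoeff h (n + 1) * chebJ_neg_half_succ_add n θ
    have hval : f (cos θ) = S -
        (S - ∑ i ∈ Finset.range 1, cosCoeff h i * chebJ (-(1 / 2)) i (cos θ) -
          (h θ + cosCoeff h 0 - ∑ i ∈ Finset.range 1, 2 * cosCoeff h i * cos (i * θ))) := by
      simp [chebJ]
      ring
    rw [hterm, hval]
    exact h0.sub (h2.sub hT2)

/-- Character expansion of a product: summing
`det[⟨J_{μ̃_j,α},(x−1)^{r−i}E⟩_α]·det[J_{μ̃_i,α}(x_j)]` over all partitions `μ` of
length at most `r` (with `μ̃_j = μ_j + r − j`) gives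
`(∏_k E(x_k))·det[(x_j−1)^{r−i}]`. -/
theorem character_expansion (E : ℝ → ℝ) (U : Set ℝ) (hU : IsOpen U)
    (hsub : Set.Icc (-1 : ℝ) 1 ⊆ U) (hE : ContDiffOn ℝ (⊤ : ℕ∞) E U)
    (r : ℕ) (hr : 1 ≤ r) (α : ℝ) (hα : α = 1 / 2 ∨ α = -(1 / 2))
    (xs : Fin r → ℝ) (hxs : ∀ k, xs k ∈ Set.Icc (-1 : ℝ) 1) :
    HasSum
      (fun μ : { m : Fin r → ℕ // Antitone m } =>
        Matrix.det (Matrix.of fun i j : Fin r =>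
          innerJ α (chebJ α (μ.1 j + (r - 1 - (j : ℕ))))
            (fun x => (x - 1) ^ (r - 1 - (i : ℕ)) * E x)) *
        Matrix.det (Matrix.of fun i j : Fin r =>
          chebJ α (μ.1 i + (r - 1 - (i : ℕ))) (xs j)))
      ((∏ k, E (xs k)) *
        Matrix.det (Matrix.of fun i j : Fin r => (xs j - 1) ^ (r - 1 - (i : ℕ)))) := by
  have hexp : ∀ i j : Fin r, HasSum
      (fun n => innerJ α (chebJ α n) (fun x => (x - 1) ^ (r - 1 - (i : ℕ)) * E x) *
        chebJ α n (xs j)) ((xs j - 1) ^ (r - 1 - (i : ℕ)) * E (xs j)) := fun i j =>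
    hasSum_innerJ_mul_chebJ hα hsub (f := fun x => (x - 1) ^ (r - 1 - (i : ℕ)) * E x)
      (ContDiffOn.mul (by fun_prop) (by exact_mod_cast contDiffOn_infty.1 hE 3))
      (hxs j)
  have key := hasSum_det_mul_det
    (s := Matrix.of fun i j : Fin r => (xs j - 1) ^ (r - 1 - (i : ℕ)) * E (xs j)) hexp
  rw [← Matrix.det_mul_row]
  simpa only [addStaircase, Matrix.of_apply, mul_comm (E _)] using key
end
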